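/- Let G be a plane triangulation, let G' = G − X be a weak near-triangulation obtained from G by deleting a set X of vertices, and suppose at least one external vertex of G belongs to X. Then every external vertex of G' is adjacent in G to a vertex of X. -/

import Mathlib

open Set

/-- A plane graph: a finite simple graph whose vertices are points of the plane,
together with a plane embedding in which every edge is drawn as an arc (the range of an
injective path) joining its endpoints, two arcs meet only in common endpoints, and
no vertex lies on an arc other than at its endpoints. -/
structure PlaneGraph where
  verts : Set (ℝ × ℝ)
  finite_verts : verts.Finite
  Adj : (ℝ × ℝ) → (ℝ × ℝ) → Prop
  adj_symm : ∀ u v, Adj u v → Adj v u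
  adj_irrefl : ∀ v, ¬ Adj v v
  adj_mem : ∀ u v, Adj u v → u ∈ verts
  arc : (ℝ × ℝ) → (ℝ × ℝ) → Set (ℝ × ℝ)
  arc_symm : ∀ u v, arc u v = arc v u
  arc_path : ∀ u v, Adj u v → ∃ γ : Path u v, Function.Injective ⇑γ ∧ arc u v = Set.range ⇑γ
  arc_verts : ∀ u v, Adj u v → verts ∩ arc u v ⊆ {u, v}
  arc_inter : ∀ u v u' v', Adj u v → Adj u' v' → ({u, v} : Set (ℝ × ℝ)) ≠ {u', v'} →
    arc u v ∩ arc u' v' ⊆ ({u, v} : Set (ℝ × ℝ)) ∩ {u', v'}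

namespace PlaneGraph

/-- The plane subgraph induced on a set of vertices, with the inherited embedding. -/
def induce (G : PlaneGraph) (S : Set (ℝ × ℝ)) : PlaneGraph where
  verts := G.verts ∩ S
  finite_verts := G.finite_verts.subset inter_subset_left
  Adj u v := G.Adj u v ∧ u ∈ S ∧ v ∈ S
  adj_symm _ _ h := ⟨G.adj_symm _ _ h.1, h.2.2, h.2.1⟩
  adj_irrefl v h := G.adj_irrefl v h.1
  adj_mem _ _ h := ⟨G.adj_mem _ _ h.1, h.2.1⟩
  arc := G.arc
  arc_symm := G.arc_symm
  arc_path _ _ h := G.arc_path _ _ h.1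
  arc_verts _ _ h := fun _ hx => G.arc_verts _ _ h.1 ⟨hx.1.1, hx.2⟩
  arc_inter _ _ _ _ h h' hne := G.arc_inter _ _ _ _ h.1 h'.1 hne

/-- Deleting a set of vertices (together with all incident edges),
keeping the inherited embedding. -/
def delete (G : PlaneGraph) (X : Set (ℝ × ℝ)) : PlaneGraph := G.induce Xᶜ

/-- Deleting a single vertex. -/
def erase (G : PlaneGraph) (x : ℝ × ℝ) : PlaneGraph := G.delete {x}

/-- The point set of the plane drawing of `G`. -/
def drawing (G : PlaneGraph) : Set (ℝ × ℝ) :=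
  G.verts ∪ ⋃ (u) (v) (_ : G.Adj u v), G.arc u v

/-- The faces of `G`: connected components of the complement of the drawing. -/
def IsFace (G : PlaneGraph) (F : Set (ℝ × ℝ)) : Prop :=
  ∃ x, x ∉ G.drawing ∧ F = connectedComponentIn G.drawingᶜ x

/-- A vertex is external if it is incident to (i.e. lies on the boundary of)
an unbounded face. -/
def ExternalVertex (G : PlaneGraph) (v : ℝ × ℝ) : Prop :=
  v ∈ G.verts ∧ ∃ F, G.IsFace F ∧ ¬ Bornology.IsBounded F ∧ v ∈ closure F

/-- A triangle (cycle on three vertices) of `G`. -/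
def IsTriangle (G : PlaneGraph) (a b c : ℝ × ℝ) : Prop :=
  a ≠ b ∧ a ≠ c ∧ b ≠ c ∧ G.Adj a b ∧ G.Adj b c ∧ G.Adj a c

/-- `v` is contained in a triangle of `G`. -/
def InTriangle (G : PlaneGraph) (v : ℝ × ℝ) : Prop := ∃ b c, G.IsTriangle v b c

/-- The drawing of the closed curve formed by a triangle on `a`, `b`, `c`. -/
def triDrawing (G : PlaneGraph) (a b c : ℝ × ℝ) : Set (ℝ × ℝ) :=
  G.arc a b ∪ G.arc b c ∪ G.arc a c

/-- A face is triangular if its boundary is the drawing of a triangle of `G`. -/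
def IsTriangularFace (G : PlaneGraph) (F : Set (ℝ × ℝ)) : Prop :=
  ∃ a b c, G.IsTriangle a b c ∧ frontier F = G.triDrawing a b c

/-- The interior region of the closed curve drawn by a triangle: the union of the
bounded connected components of the complement of its drawing. -/
def triangleInterior (G : PlaneGraph) (a b c : ℝ × ℝ) : Set (ℝ × ℝ) :=
  {x | x ∉ G.triDrawing a b c ∧
    Bornology.IsBounded (connectedComponentIn (G.triDrawing a b c)ᶜ x)}

/-- A facial triangle: a triangle whose interior region is a face of `G`. -/
def IsFacialTriangle (G : PlaneGraph) (a b c : ℝ × ℝ) : Prop :=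
  G.IsTriangle a b c ∧ G.IsFace (G.triangleInterior a b c)

/-- A weak near-triangulation: every bounded face is triangular and every vertex
is contained in a triangle. -/
def IsWNT (G : PlaneGraph) : Prop :=
  (∀ F, G.IsFace F → Bornology.IsBounded F → G.IsTriangularFace F) ∧
  ∀ v ∈ G.verts, G.InTriangle v

/-- Reachability by walks in `G`. -/
def Reachable (G : PlaneGraph) (u v : ℝ × ℝ) : Prop := Relation.ReflTransGen G.Adj u v

/-- Connectedness of `G`. -/
def Connected (G : PlaneGraph) : Prop :=
  G.verts.Nonempty ∧ ∀ u ∈ G.verts, ∀ v ∈ G.verts, G.Reachable u v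

/-- A cutvertex: a vertex whose deletion separates two other vertices. -/
def IsCutvertex (G : PlaneGraph) (v : ℝ × ℝ) : Prop :=
  v ∈ G.verts ∧ ∃ a b, a ∈ G.verts ∧ b ∈ G.verts ∧ a ≠ v ∧ b ≠ v ∧
    G.Reachable a b ∧ ¬ (G.erase v).Reachable a b

/-- 2-connectivity: connected, on at least three vertices, with no cutvertex. -/
def TwoConnected (G : PlaneGraph) : Prop :=
  G.Connected ∧ 3 ≤ G.verts.ncard ∧ ∀ v, ¬ G.IsCutvertex v

/-- A near-triangulation: a 2-connected plane graph all of whose bounded faces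
are triangular. -/
def IsNearTriangulation (G : PlaneGraph) : Prop :=
  G.TwoConnected ∧ ∀ F, G.IsFace F → Bornology.IsBounded F → G.IsTriangularFace F

/-- A plane triangulation: a connected plane graph all of whose faces (including
the unbounded one) are triangular. -/
def IsTriangulation (G : PlaneGraph) : Prop :=
  G.Connected ∧ ∀ F, G.IsFace F → G.IsTriangularFace F

/-- A block of `G`, given by its vertex set `B`: a maximal set of vertices inducing
a connected subgraph without a cutvertex. -/
def IsBlock (G : PlaneGraph) (B : Set (ℝ × ℝ)) : Prop :=
  B ⊆ G.verts ∧ (G.induce B).Connected ∧ (∀ v, ¬ (G.induce B).IsCutvertex v) ∧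
  ∀ B', B ⊆ B' → B' ⊆ G.verts → (G.induce B').Connected →
    (∀ v, ¬ (G.induce B').IsCutvertex v) → B' = B

/-- A plane graph is outerplanar if all of its vertices are incident to the
unbounded face. -/
def IsOuterplanar (G : PlaneGraph) : Prop := ∀ v ∈ G.verts, G.ExternalVertex v

/-- A dominating set of `G`. -/
def IsDominatingSet (G : PlaneGraph) (D : Set (ℝ × ℝ)) : Prop :=
  D ⊆ G.verts ∧ ∀ v ∈ G.verts, v ∉ D → ∃ d ∈ D, G.Adj v d

/-- The domination number of `G`. -/
noncomputable def dominationNumber (G : PlaneGraph) : ℕ :=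
  sInf {n | ∃ D, G.IsDominatingSet D ∧ D.ncard = n}

/-- `u` is problematic in `G` if `G − u` is not a weak near-triangulation. -/
def Problematic (G : PlaneGraph) (u : ℝ × ℝ) : Prop := ¬ (G.erase u).IsWNT

/-- `x` is a `u`-bad vertex in `G`: a vertex of `G − u` not contained in a triangle
of `G − u`. -/
def IsBadFor (G : PlaneGraph) (u x : ℝ × ℝ) : Prop :=
  x ∈ G.verts ∧ x ≠ u ∧ ¬ (G.erase u).InTriangle x

end PlaneGraph

/-- A preconnected set that meets both `t` and its complement meets the frontier of `t`. -/
theorem IsPreconnected.inter_frontier_nonempty {α : Type*} [TopologicalSpace α] {s t : Set α}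
    (hs : IsPreconnected s) (ht : (s ∩ t).Nonempty) (htc : (s ∩ tᶜ).Nonempty) :
    (s ∩ frontier t).Nonempty := by
  by_contra! hempty
  have hnot : ∀ x ∈ s, x ∈ closure t → x ∈ interior t := fun x hx hxc => by
    by_contra hxi
    exact (hempty ▸ (⟨hx, hxc, hxi⟩ : x ∈ s ∩ frontier t) : x ∈ (∅ : Set α))
  obtain ⟨x, hxs, hxt⟩ := ht
  obtain ⟨y, hys, hyt⟩ := htc
  obtain ⟨z, -, hzi, hzc⟩ := hs (interior t) (closure t)ᶜ isOpen_interior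
    isClosed_closure.isOpen_compl
    (fun z hz => (em (z ∈ closure t)).imp (hnot z hz) id)
    ⟨x, hxs, hnot x hxs (subset_closure hxt)⟩
    ⟨y, hys, fun hyc => hyt (interior_subset (hnot y hys hyc))⟩
  exact hzc (interior_subset_closure hzi)

/-- The exterior of a ball in a real normed space of dimension at least two is connected. -/
theorem isPreconnected_compl_closedBall_zero {E : Type*} [NormedAddCommGroup E]
    [NormedSpace ℝ E] (h : 1 < Module.rank ℝ E) {R : ℝ} (hR : 0 ≤ R) :
    IsPreconnected (Metric.closedBall (0 : E) R)ᶜ := by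
  have himage : (Metric.closedBall (0 : E) R)ᶜ =
      (fun p : E × ℝ => p.2 • p.1) '' (Metric.sphere (0 : E) 1 ×ˢ Ioi R) := by
    ext x
    constructor
    · intro hx
      have hx' : R < ‖x‖ := by simpa using hx
      have hpos : ‖x‖ ≠ 0 := (hR.trans_lt hx').ne'
      exact ⟨(‖x‖⁻¹ • x, ‖x‖), ⟨by simp [norm_smul, hpos], hx'⟩, by simp [smul_smul, hpos]⟩
    · rintro ⟨⟨y, t⟩, ⟨hy, ht⟩, rfl⟩
      have hy' : ‖y‖ = 1 := by simpa using hy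
      have ht' : R < t := ht
      simpa [norm_smul, hy'] using ht'.trans_le (le_abs_self t)
  rw [himage]
  exact ((isPreconnected_sphere h 0 1).prod isPreconnected_Ioi).image _ (by fun_prop)

/-- The complement of a bounded set in a real normed space of dimension at least two has at
most one unbounded connected component. -/
theorem connectedComponentIn_compl_eq_of_not_isBounded {E : Type*} [NormedAddCommGroup E]
    [NormedSpace ℝ E] (h : 1 < Module.rank ℝ E) {s : Set E} (hs : Bornology.IsBounded s)
    {x y : E} (hx : ¬ Bornology.IsBounded (connectedComponentIn sᶜ x))
    (hy : ¬ Bornology.IsBounded (connectedComponentIn sᶜ y)) :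
    connectedComponentIn sᶜ x = connectedComponentIn sᶜ y := by
  obtain ⟨R, hR, hsR⟩ := hs.subset_closedBall_lt 0 0
  have exists_far : ∀ z, ¬ Bornology.IsBounded (connectedComponentIn sᶜ z) →
      ∃ w ∈ connectedComponentIn sᶜ z, w ∈ (Metric.closedBall (0 : E) R)ᶜ := by
    intro z hz
    by_contra! hfar
    exact hz (Metric.isBounded_closedBall.subset fun w hw => not_not.mp (hfar w hw))
  obtain ⟨p, hp, hpR⟩ := exists_far x hx
  obtain ⟨q, hq, hqR⟩ := exists_far y hy
  have hpq : q ∈ connectedComponentIn sᶜ p :=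
    (isPreconnected_compl_closedBall_zero h hR.le).subset_connectedComponentIn hpR
      (compl_subset_compl.mpr hsR) hqR
  rw [connectedComponentIn_eq hp, connectedComponentIn_eq hq, connectedComponentIn_eq hpq]

namespace PlaneGraph

theorem adj_mem_right (G : PlaneGraph) {u v : ℝ × ℝ} (h : G.Adj u v) : v ∈ G.verts :=
  G.adj_mem v u (G.adj_symm u v h)

theorem isCompact_arc (G : PlaneGraph) {u v : ℝ × ℝ} (h : G.Adj u v) :
    IsCompact (G.arc u v) := by
  obtain ⟨γ, -, hγ⟩ := G.arc_path u v h
  rw [hγ]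
  exact isCompact_range γ.continuous

theorem finite_setOf_adj (G : PlaneGraph) :
    {e : (ℝ × ℝ) × (ℝ × ℝ) | G.Adj e.1 e.2}.Finite :=
  (G.finite_verts.prod G.finite_verts).subset fun _ he =>
    ⟨G.adj_mem _ _ he, G.adj_mem_right he⟩

/-- A union of arcs of edges of a plane graph is compact. -/
theorem isCompact_biUnion_arc (G : PlaneGraph) {s : Set ((ℝ × ℝ) × (ℝ × ℝ))}
    (hs : s ⊆ {e | G.Adj e.1 e.2}) : IsCompact (⋃ e ∈ s, G.arc e.1 e.2) :=
  (G.finite_setOf_adj.subset hs).isCompact_biUnion fun _ he => G.isCompact_arc (hs he)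

theorem mem_drawing (G : PlaneGraph) {x : ℝ × ℝ} :
    x ∈ G.drawing ↔ x ∈ G.verts ∨ ∃ u v, G.Adj u v ∧ x ∈ G.arc u v := by
  simp [drawing]

theorem isCompact_drawing (G : PlaneGraph) : IsCompact G.drawing := by
  have hdrawing : G.drawing =
      G.verts ∪ ⋃ e ∈ {e : (ℝ × ℝ) × (ℝ × ℝ) | G.Adj e.1 e.2}, G.arc e.1 e.2 := by
    ext x
    simp [mem_drawing]
  rw [hdrawing]
  exact G.finite_verts.isCompact.union (G.isCompact_biUnion_arc subset_rfl)

theorem drawing_delete_subset (G : PlaneGraph) (X : Set (ℝ × ℝ)) :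
    (G.delete X).drawing ⊆ G.drawing := by
  intro x hx
  rw [mem_drawing] at hx ⊢
  exact hx.imp (fun h => h.1) fun ⟨u, v, h, hxe⟩ => ⟨u, v, h.1, hxe⟩

theorem IsFace.isOpen {G : PlaneGraph} {F : Set (ℝ × ℝ)} (hF : G.IsFace F) : IsOpen F := by
  obtain ⟨x, -, rfl⟩ := hF
  exact G.isCompact_drawing.isClosed.isOpen_compl.connectedComponentIn

theorem IsFace.isPreconnected {G : PlaneGraph} {F : Set (ℝ × ℝ)} (hF : G.IsFace F) :
    IsPreconnected F := by
  obtain ⟨x, -, rfl⟩ := hF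
  exact isPreconnected_connectedComponentIn

theorem IsFace.disjoint_drawing {G : PlaneGraph} {F : Set (ℝ × ℝ)} (hF : G.IsFace F) :
    Disjoint F G.drawing := by
  obtain ⟨x, -, rfl⟩ := hF
  exact disjoint_left.mpr (connectedComponentIn_subset _ _)

/-- A plane graph has at most one unbounded face. -/
theorem IsFace.eq_of_not_isBounded {G : PlaneGraph} {F F' : Set (ℝ × ℝ)} (hF : G.IsFace F)
    (hF' : G.IsFace F') (hb : ¬ Bornology.IsBounded F) (hb' : ¬ Bornology.IsBounded F') :
    F = F' := by
  obtain ⟨x, -, rfl⟩ := hF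
  obtain ⟨y, -, rfl⟩ := hF'
  refine connectedComponentIn_compl_eq_of_not_isBounded ?_ G.isCompact_drawing.isBounded hb hb'
  rw [rank_prod']
  simp only [Module.rank_self]
  exact_mod_cast one_lt_two

theorem mem_of_mem_triDrawing (G : PlaneGraph) {a b c v : ℝ × ℝ} (hT : G.IsTriangle a b c)
    (hv : v ∈ G.verts) (hvT : v ∈ G.triDrawing a b c) : v = a ∨ v = b ∨ v = c := by
  obtain ⟨-, -, -, hab, hbc, hac⟩ := hT
  rcases hvT with (h | h) | h
  · rcases G.arc_verts _ _ hab ⟨hv, h⟩ with h | h <;> simp_all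
  · rcases G.arc_verts _ _ hbc ⟨hv, h⟩ with h | h <;> simp_all
  · rcases G.arc_verts _ _ hac ⟨hv, h⟩ with h | h <;> simp_all

/-- Every vertex has a convex neighbourhood which meets only arcs of edges incident to it,
and contains no other vertex. -/
theorem exists_ball_avoiding (G : PlaneGraph) {v : ℝ × ℝ} (hv : v ∈ G.verts) :
    ∃ r > 0, (∀ x ∈ Metric.ball v r, x ∈ G.verts → x = v) ∧
      ∀ x ∈ Metric.ball v r, ∀ u w, G.Adj u w → x ∈ G.arc u w → v = u ∨ v = w := by
  set s : Set ((ℝ × ℝ) × (ℝ × ℝ)) := {e | G.Adj e.1 e.2 ∧ v ≠ e.1 ∧ v ≠ e.2} with hs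
  set K : Set (ℝ × ℝ) := G.verts \ {v} ∪ ⋃ e ∈ s, G.arc e.1 e.2 with hK
  have hKclosed : IsClosed K :=
    (G.finite_verts.subset sdiff_subset).isClosed.union
      (G.isCompact_biUnion_arc fun _ he => he.1).isClosed
  have hvK : v ∉ K := by
    rintro (h | h)
    · exact h.2 rfl
    · simp only [mem_iUnion] at h
      obtain ⟨e, ⟨he, hv1, hv2⟩, hve⟩ := h
      rcases G.arc_verts _ _ he ⟨hv, hve⟩ with h | h
      · exact hv1 h
      · exact hv2 h
  obtain ⟨r, hr, hball⟩ := Metric.isOpen_iff.mp hKclosed.isOpen_compl v hvK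
  refine ⟨r, hr, fun x hx hxv => ?_, fun x hx u w huw hxe => ?_⟩
  · by_contra hne
    exact hball hx (Or.inl ⟨hxv, hne⟩)
  · by_contra! hne
    exact hball hx (Or.inr (mem_biUnion (x := (u, w)) ⟨huw, hne⟩ hxe))

/-- If a vertex `v` of `G − X` has no neighbour in `X`, then every face of `G − X` with `v` in
its closure meets a face of `G` whose bounding triangle passes through `v`. -/
theorem exists_isFace_frontier_eq_triDrawing (G : PlaneGraph) (hG : G.IsTriangulation)
    {X : Set (ℝ × ℝ)} {v : ℝ × ℝ} (hv : v ∈ (G.delete X).verts)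
    (hvX : ∀ w ∈ X, ¬ G.Adj v w) {F' : Set (ℝ × ℝ)} (hF' : (G.delete X).IsFace F')
    (hvF' : v ∈ closure F') :
    ∃ F, G.IsFace F ∧ (F' ∩ F).Nonempty ∧ ∃ a b c, G.IsTriangle a b c ∧
      frontier F = G.triDrawing a b c ∧ (v = a ∨ v = b ∨ v = c) := by
  obtain ⟨r, hr, hverts, harcs⟩ := G.exists_ball_avoiding hv.1
  obtain ⟨x, hxF', hxv⟩ := Metric.mem_closure_iff.mp hvF' r hr
  have hxball : x ∈ Metric.ball v r := Metric.mem_ball'.mpr hxv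
  have hxG' : x ∉ (G.delete X).drawing := disjoint_left.mp hF'.disjoint_drawing hxF'
  have hxG : x ∉ G.drawing := by
    intro hx
    apply hxG'
    rw [mem_drawing] at hx ⊢
    rcases hx with hx | ⟨u, w, huw, hx⟩
    · exact Or.inl (hverts x hxball hx ▸ hv)
    · refine Or.inr ⟨u, w, ⟨huw, ?_, ?_⟩, hx⟩ <;>
        rcases harcs x hxball u w huw hx with rfl | rfl
      · exact hv.2
      · exact fun h => hvX u h (G.adj_symm _ _ huw)
      · exact fun h => hvX w h huw
      · exact hv.2
  have hF : G.IsFace (connectedComponentIn G.drawingᶜ x) := ⟨x, hxG, rfl⟩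
  have hxF : x ∈ connectedComponentIn G.drawingᶜ x := mem_connectedComponentIn hxG
  obtain ⟨a, b, c, hT, hfr⟩ := hG.2 _ hF
  refine ⟨_, hF, ⟨x, hxF', hxF⟩, a, b, c, hT, hfr, ?_⟩
  have hvF : v ∉ connectedComponentIn G.drawingᶜ x := fun h =>
    disjoint_left.mp hF.disjoint_drawing h (Or.inl hv.1)
  obtain ⟨p, hpball, hp⟩ :=
    (Metric.isPreconnected_ball (x := v) (r := r)).inter_frontier_nonempty
      ⟨x, hxball, hxF⟩ ⟨v, Metric.mem_ball_self hr, hvF⟩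
  rw [hfr] at hp
  obtain ⟨-, -, -, hab, hbc, hac⟩ := hT
  rcases hp with (hp | hp) | hp
  · have := harcs p hpball _ _ hab hp
    tauto
  · have := harcs p hpball _ _ hbc hp
    tauto
  · have := harcs p hpball _ _ hac hp
    tauto

end PlaneGraph

open PlaneGraph in
/-- Let `G` be a plane triangulation and `G' = G − X` a weak near-triangulation, where
`X` contains at least one external vertex of `G`. Then every external vertex of `G'`
is adjacent in `G` to a vertex of `X`. -/
theorem triangulation_delete_external (G : PlaneGraph) (hG : G.IsTriangulation)
    (X : Set (ℝ × ℝ)) (hX : X ⊆ G.verts) (hWNT : (G.delete X).IsWNT)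
    (hext : ∃ v ∈ X, G.ExternalVertex v) :
    ∀ v, (G.delete X).ExternalVertex v → ∃ w ∈ X, G.Adj v w := by
  intro v ⟨hv, F', hF', hF'b, hvF'⟩
  by_contra! hvX
  obtain ⟨F, hF, hmeet, a, b, c, hT, hfr, hvT⟩ :=
    G.exists_isFace_frontier_eq_triDrawing hG hv hvX hF' hvF'
  obtain ⟨-, -, -, hab, hbc, hac⟩ := id hT
  have hmem : a ∉ X ∧ b ∉ X ∧ c ∉ X := by
    have hvX' : v ∉ X := hv.2
    have hba := G.adj_symm _ _ hab
    have hcb := G.adj_symm _ _ hbc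
    have hca := G.adj_symm _ _ hac
    rcases hvT with rfl | rfl | rfl
    · exact ⟨hvX', fun h => hvX _ h hab, fun h => hvX _ h hac⟩
    · exact ⟨fun h => hvX _ h hba, hvX', fun h => hvX _ h hbc⟩
    · exact ⟨fun h => hvX _ h hca, fun h => hvX _ h hcb, hvX'⟩
  have hfrG' : frontier F ⊆ (G.delete X).drawing := by
    rw [hfr]
    intro p hp
    rw [mem_drawing]
    rcases hp with (hp | hp) | hp
    · exact Or.inr ⟨a, b, ⟨hab, hmem.1, hmem.2.1⟩, hp⟩
    · exact Or.inr ⟨b, c, ⟨hbc, hmem.2.1, hmem.2.2⟩, hp⟩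
    · exact Or.inr ⟨a, c, ⟨hac, hmem.1, hmem.2.2⟩, hp⟩
  have hsub : F' ⊆ F := by
    intro y hy
    by_contra hyF
    obtain ⟨p, hpF', hp⟩ := hF'.isPreconnected.inter_frontier_nonempty hmeet ⟨y, hy, hyF⟩
    exact disjoint_left.mp hF'.disjoint_drawing hpF' (hfrG' hp)
  obtain ⟨w, hwX, hw, F₁, hF₁, hF₁b, hwF₁⟩ := hext
  obtain rfl : F₁ = F := hF₁.eq_of_not_isBounded hF hF₁b fun hb => hF'b (hb.subset hsub)
  have hwfr : w ∈ frontier F₁ := by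
    rw [hF.isOpen.frontier_eq]
    exact ⟨hwF₁, fun h => disjoint_left.mp hF.disjoint_drawing h (Or.inl hw)⟩
  rw [hfr] at hwfr
  rcases G.mem_of_mem_triDrawing hT hw hwfr with rfl | rfl | rfl
  · exact hmem.1 hwX
  · exact hmem.2.1 hwX
  · exact hmem.2.2 hwX
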